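/- arXiv:1704.00633 — 10 statements merged into one kernel-verified Lean document; each statement's English description precedes it below -/
import Mathlib

section
/- Let n, m be natural numbers with 1 ≤ m and 2m ≤ n, and let d be a nonnegative real number. Let W be an integer-valued random variable (on a probability space) with W ≤ m almost surely and E[W] ≤ m − d. Then E[log₂ C(n,m) − log₂ C(n,W)] ≥ d · log₂(n/m − 1). -/
theorem logb_choose_add_le_logb_choose_succ {n m k : ℕ} (hk : k < m) (hmn : m < n) :
    Real.logb 2 (n.choose k) + Real.logb 2 ((n : ℝ) / (m : ℝ) - 1) ≤
      Real.logb 2 (n.choose (k + 1)) := by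
  have hm : (0 : ℝ) < m := by exact_mod_cast (by omega : 0 < m)
  have hmn' : (m : ℝ) < n := by exact_mod_cast hmn
  have hk' : (k : ℝ) + 1 ≤ m := by exact_mod_cast hk
  have hc : (0 : ℝ) < n.choose k := by exact_mod_cast Nat.choose_pos (by omega)
  have hrec : (n.choose (k + 1) : ℝ) * (k + 1) = n.choose k * (n - k) := by
    have h := Nat.choose_succ_right_eq n k
    rw [← Nat.cast_sub (by omega : k ≤ n)]
    exact_mod_cast h
  have hr : (0 : ℝ) < (n : ℝ) / m - 1 := by
    rw [sub_pos, one_lt_div hm]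
    exact hmn'
  have hratio : ((n : ℝ) / m - 1) * (k + 1) ≤ n - k := by
    rw [div_sub_one hm.ne', div_mul_eq_mul_div, div_le_iff₀ hm]
    nlinarith
  rw [← Real.logb_mul hc.ne' hr.ne']
  refine Real.logb_le_logb_of_le one_lt_two (mul_pos hc hr) ?_
  refine le_of_mul_le_mul_right ?_ (by positivity : (0 : ℝ) < k + 1)
  rw [hrec, mul_assoc]
  exact mul_le_mul_of_nonneg_left hratio hc.le

theorem sub_mul_logb_le_logb_choose_sub {n m w k : ℕ} (hwk : w ≤ k) (hkm : k ≤ m) (hmn : m < n) :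
    ((k : ℝ) - w) * Real.logb 2 ((n : ℝ) / (m : ℝ) - 1) ≤
      Real.logb 2 (n.choose k) - Real.logb 2 (n.choose w) := by
  induction k, hwk using Nat.le_induction with
  | base => simp
  | succ k _ ih =>
    have h := ih (by omega)
    have hstep := logb_choose_add_le_logb_choose_succ (n := n) (m := m) (k := k) (by omega) hmn
    push_cast
    linarith

theorem stmt3 {Ω : Type*} [Fintype Ω] (p : Ω → ℝ)
    (hp0 : ∀ ω, 0 ≤ p ω) (hp1 : ∑ ω, p ω = 1)
    (n m : ℕ) (hm : 1 ≤ m) (hn : 2 * m ≤ n)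
    (d : ℝ) (hd : 0 ≤ d)
    (W : Ω → ℕ)
    (hWm : ∀ ω, p ω ≠ 0 → W ω ≤ m)
    (hEW : ∑ ω, p ω * (W ω : ℝ) ≤ (m : ℝ) - d) :
    ∑ ω, p ω * (Real.logb 2 (n.choose m) - Real.logb 2 (n.choose (W ω))) ≥
      d * Real.logb 2 ((n : ℝ) / (m : ℝ) - 1) := by
  have hm0 : (0 : ℝ) < m := by exact_mod_cast hm
  have hn' : 2 * (m : ℝ) ≤ n := by exact_mod_cast hn
  have hL : 0 ≤ Real.logb 2 ((n : ℝ) / (m : ℝ) - 1) := by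
    refine Real.logb_nonneg one_lt_two ?_
    rw [le_sub_iff_add_le, le_div_iff₀ hm0]
    linarith
  calc d * Real.logb 2 ((n : ℝ) / (m : ℝ) - 1)
      ≤ (∑ ω, p ω * ((m : ℝ) - W ω)) * Real.logb 2 ((n : ℝ) / (m : ℝ) - 1) := by
        refine mul_le_mul_of_nonneg_right ?_ hL
        simp only [mul_sub, Finset.sum_sub_distrib, ← Finset.sum_mul, hp1]
        linarith
    _ ≤ _ := by
        rw [Finset.sum_mul]
        refine Finset.sum_le_sum fun ω _ => ?_
        by_cases h : p ω = 0
        · simp [h]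
        · rw [mul_assoc]
          exact mul_le_mul_of_nonneg_left
            (sub_mul_logb_le_logb_choose_sub (hWm ω h) le_rfl (by omega)) (hp0 ω)
end

section
/- For every integer K ≥ 1 and every integer N ≥ 1, the partial product ∏_{j=1}^{N} 1/(1 − 2^{−j/K}) is at most 2^{5K}. Consequently the infinite product ∏_{j=1}^{∞} 1/(1 − 2^{−j/K}) is at most 2^{5K}. -/
/-- A geometric sum over a finite set of positive exponents. -/
lemma sum_pow_le_div_one_sub {y : ℝ} (hy0 : 0 ≤ y) (hy1 : y < 1) {s : Finset ℕ} (hs : 0 ∉ s) :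
    ∑ j ∈ s, y ^ j ≤ y / (1 - y) := by
  have h : ∑ j ∈ insert 0 s, y ^ j ≤ (1 - y)⁻¹ :=
    sum_le_hasSum _ (fun _ _ => by positivity) (hasSum_geometric_of_lt_one hy0 hy1)
  rw [Finset.sum_insert hs, pow_zero] at h
  have h1 : 0 < 1 - y := by linarith
  have h2 : y / (1 - y) = (1 - y)⁻¹ - 1 := by field_simp; ring
  linarith

lemma exp_neg_div_one_sub_exp_neg_le {t : ℝ} (ht : 0 < t) :
    Real.exp (-t) / (1 - Real.exp (-t)) ≤ 1 / t := by
  have h1 : Real.exp (-t) < 1 := Real.exp_lt_one_iff.mpr (by linarith)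
  rw [div_le_div_iff₀ (by linarith) ht]
  have h2 : Real.exp (-t) * (t + 1) ≤ Real.exp (-t) * Real.exp t :=
    mul_le_mul_of_nonneg_left (Real.add_one_le_exp t) (Real.exp_pos _).le
  rw [← Real.exp_add, neg_add_cancel, Real.exp_zero] at h2
  linarith

/-- Logarithmic form of the bound `∏ (1 - e ^ (-a j))⁻¹ ≤ e ^ (π ^ 2 / (6 a))`. -/
lemma sum_neg_log_one_sub_exp_le {a : ℝ} (ha : 0 < a) {s : Finset ℕ} (hs : 0 ∉ s) :
    ∑ j ∈ s, -Real.log (1 - Real.exp (-a) ^ j) ≤ Real.pi ^ 2 / 6 / a := by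
  have hq : Real.exp (-a) < 1 := Real.exp_lt_one_iff.mpr (by linarith)
  have hlog : HasSum (fun n : ℕ => ∑ j ∈ s, (Real.exp (-a) ^ j) ^ (n + 1) / ((n : ℝ) + 1))
      (∑ j ∈ s, -Real.log (1 - Real.exp (-a) ^ j)) := by
    refine hasSum_sum fun j hj => Real.hasSum_pow_div_log_of_abs_lt_one ?_
    rw [abs_of_pos (by positivity)]
    exact pow_lt_one₀ (Real.exp_pos _).le hq (fun h => hs (h ▸ hj))
  have hzeta : HasSum (fun n : ℕ => 1 / ((n + 1 : ℕ) : ℝ) ^ 2 / a) (Real.pi ^ 2 / 6 / a) := by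
    refine HasSum.div_const ?_ a
    simpa using (hasSum_nat_add_iff' 1).mpr hasSum_zeta_two
  refine hasSum_le (fun n => ?_) hlog hzeta
  have hn : (0 : ℝ) < (n : ℝ) + 1 := by positivity
  have hexp : Real.exp (-a) ^ (n + 1) = Real.exp (-(((n : ℝ) + 1) * a)) := by
    rw [← Real.exp_nat_mul]; push_cast; ring_nf
  have hgeom := (sum_pow_le_div_one_sub (Real.exp_pos (-(((n : ℝ) + 1) * a))).le
    (Real.exp_lt_one_iff.mpr (neg_neg_of_pos (by positivity))) hs).trans
    (exp_neg_div_one_sub_exp_neg_le (by positivity))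
  rw [← Finset.sum_div, div_le_iff₀ hn]
  calc ∑ j ∈ s, (Real.exp (-a) ^ j) ^ (n + 1)
      = ∑ j ∈ s, Real.exp (-(((n : ℝ) + 1) * a)) ^ j := by
        rw [← hexp]
        exact Finset.sum_congr rfl fun j _ => pow_right_comm _ _ _
    _ ≤ 1 / (((n : ℝ) + 1) * a) := hgeom
    _ = 1 / ((n + 1 : ℕ) : ℝ) ^ 2 / a * ((n : ℝ) + 1) := by push_cast; field_simp

lemma prod_inv_one_sub_two_rpow_le {K : ℕ} (hK : 1 ≤ K) {s : Finset ℕ} (hs : 0 ∉ s) :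
    ∏ j ∈ s, (1 - (2 : ℝ) ^ (-(j : ℝ) / (K : ℝ)))⁻¹ ≤ 2 ^ (5 * K) := by
  have hK0 : (0 : ℝ) < K := by exact_mod_cast hK
  have hlog2 : (0 : ℝ) < Real.log 2 := Real.log_pos one_lt_two
  have ha : 0 < Real.log 2 / K := by positivity
  have hterm (j : ℕ) : (2 : ℝ) ^ (-(j : ℝ) / (K : ℝ)) = Real.exp (-(Real.log 2 / K)) ^ j := by
    rw [Real.rpow_def_of_pos two_pos, ← Real.exp_nat_mul]
    ring_nf
  have hpos : ∀ j ∈ s, 0 < 1 - Real.exp (-(Real.log 2 / K)) ^ j := fun j hj =>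
    sub_pos.mpr (pow_lt_one₀ (Real.exp_pos _).le (Real.exp_lt_one_iff.mpr (by linarith))
      (fun h => hs (h ▸ hj)))
  have hconst : Real.pi ^ 2 / 6 / (Real.log 2 / K) ≤ Real.log 2 * (5 * K) := by
    have hpi : Real.pi ^ 2 ≤ 10 := by nlinarith [Real.pi_lt_d2, Real.pi_pos]
    have hsq : 1 / 3 ≤ Real.log 2 ^ 2 := by nlinarith [Real.log_two_gt_d9]
    rw [div_le_iff₀ ha]
    have : Real.log 2 * (5 * K) * (Real.log 2 / K) = 5 * Real.log 2 ^ 2 := by field_simp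
    linarith
  calc ∏ j ∈ s, (1 - (2 : ℝ) ^ (-(j : ℝ) / (K : ℝ)))⁻¹
      = Real.exp (∑ j ∈ s, -Real.log (1 - Real.exp (-(Real.log 2 / K)) ^ j)) := by
        rw [Real.exp_sum]
        refine Finset.prod_congr rfl fun j hj => ?_
        rw [hterm, Real.exp_neg (Real.log _), Real.exp_log (hpos j hj)]
    _ ≤ Real.exp (Real.log 2 * (5 * K)) :=
        Real.exp_le_exp.mpr ((sum_neg_log_one_sub_exp_le ha hs).trans hconst)
    _ = 2 ^ (5 * K) := by
        rw [← Real.rpow_def_of_pos two_pos, ← Real.rpow_natCast]; push_cast; rfl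

theorem stmt4 (K : ℕ) (hK : 1 ≤ K) :
    (∀ N : ℕ, 1 ≤ N →
      ∏ j ∈ Finset.Icc 1 N, (1 - (2 : ℝ) ^ (-(j : ℝ) / (K : ℝ)))⁻¹ ≤ 2 ^ (5 * K)) ∧
    ∏' j : ℕ+, (1 - (2 : ℝ) ^ (-((j : ℕ) : ℝ) / (K : ℝ)))⁻¹ ≤ 2 ^ (5 * K) := by
  refine ⟨fun N _ => prod_inv_one_sub_two_rpow_le hK (by simp), ?_⟩
  by_cases hm : Multipliable fun j : ℕ+ => (1 - (2 : ℝ) ^ (-((j : ℕ) : ℝ) / (K : ℝ)))⁻¹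
  · refine le_of_tendsto hm.hasProd (Filter.Eventually.of_forall fun s => ?_)
    have h := prod_inv_one_sub_two_rpow_le hK (s := s.map ⟨PNat.val, PNat.coe_injective⟩) (by simp)
    rwa [Finset.prod_map] at h
  · rw [tprod_eq_one_of_not_multipliable hm]
    exact one_le_pow₀ one_le_two
end

section
/- For every integer K ≥ 1, the product of the first 2K factors satisfies ∏_{j=1}^{2K} 1/(1 − 2^{−j/K}) ≤ 2^{4K}. In fact ∏_{j=1}^{2K} 1/(1 − 2^{−j/K}) ≤ (8/3)^{2K} · K^{2K}/(2K)! ≤ (4e/3)^{2K} < 2^{4K}. -/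
theorem two_rpow_neg_le_one_sub {x : ℝ} (hx0 : 0 ≤ x) (hx2 : x ≤ 2) :
    (2 : ℝ) ^ (-x) ≤ 1 - 3 / 8 * x := by
  have h := rpow_one_add_le_one_add_mul_self (s := -3 / 4) (p := x / 2)
    (by norm_num) (by linarith) (by linarith)
  have e : (1 + -3 / 4 : ℝ) = (2 : ℝ) ^ (-2 : ℝ) := by
    rw [Real.rpow_neg two_pos.le, Real.rpow_two]
    norm_num
  rw [e, ← Real.rpow_mul two_pos.le, show (-2 : ℝ) * (x / 2) = -x by ring] at h
  linarith

theorem stmt5 (K : ℕ) (hK : 1 ≤ K) :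
    ∏ j ∈ Finset.Icc 1 (2 * K), (1 - (2 : ℝ) ^ (-(j : ℝ) / (K : ℝ)))⁻¹ ≤
      (8 / 3) ^ (2 * K) * (K : ℝ) ^ (2 * K) / ((2 * K).factorial : ℝ) ∧
    (8 / 3) ^ (2 * K) * (K : ℝ) ^ (2 * K) / ((2 * K).factorial : ℝ) ≤
      (4 * Real.exp 1 / 3) ^ (2 * K) ∧
    (4 * Real.exp 1 / 3) ^ (2 * K) < 2 ^ (4 * K) := by
  have hK0 : (0 : ℝ) < K := by exact_mod_cast hK
  have factor_bound : ∀ j ∈ Finset.Icc 1 (2 * K),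
      3 / 8 * ((j : ℝ) / K) ≤ 1 - (2 : ℝ) ^ (-(j : ℝ) / (K : ℝ)) ∧
        0 < 3 / 8 * ((j : ℝ) / K) := by
    intro j hj
    obtain ⟨hj1, hj2⟩ := Finset.mem_Icc.mp hj
    have hj0 : (0 : ℝ) < j := by exact_mod_cast hj1
    have hj2' : (j : ℝ) ≤ 2 * K := by exact_mod_cast hj2
    have h := two_rpow_neg_le_one_sub (x := (j : ℝ) / K) (by positivity)
      ((div_le_iff₀ hK0).mpr hj2')
    rw [neg_div]
    exact ⟨by linarith, by positivity⟩
  refine ⟨?_, ?_, ?_⟩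
  · calc ∏ j ∈ Finset.Icc 1 (2 * K), (1 - (2 : ℝ) ^ (-(j : ℝ) / (K : ℝ)))⁻¹
        ≤ ∏ j ∈ Finset.Icc 1 (2 * K), (8 / 3 * (K : ℝ)) / (j : ℝ) := by
          refine Finset.prod_le_prod (fun j hj => ?_) (fun j hj => ?_)
          · obtain ⟨h, hpos⟩ := factor_bound j hj
            exact inv_nonneg.mpr (hpos.le.trans h)
          · obtain ⟨h, hpos⟩ := factor_bound j hj
            refine (inv_anti₀ hpos h).trans_eq ?_
            rw [mul_inv, inv_div, inv_div]
            ring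
      _ = (8 / 3) ^ (2 * K) * (K : ℝ) ^ (2 * K) / ((2 * K).factorial : ℝ) := by
          rw [Finset.prod_div_distrib, Finset.prod_const, Nat.card_Icc, Nat.add_sub_cancel,
            mul_pow, ← Nat.cast_prod,
            ← Finset.Ico_add_one_right_eq_Icc, Finset.prod_Ico_id_eq_factorial]
  · have h := Real.pow_div_factorial_le_exp (2 * (K : ℝ)) (by positivity) (2 * K)
    calc (8 / 3) ^ (2 * K) * (K : ℝ) ^ (2 * K) / ((2 * K).factorial : ℝ)
        = (4 / 3) ^ (2 * K) * ((2 * (K : ℝ)) ^ (2 * K) / ((2 * K).factorial : ℝ)) := by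
          rw [← mul_div_assoc, ← mul_pow, ← mul_pow]
          ring_nf
      _ ≤ (4 / 3) ^ (2 * K) * Real.exp (2 * (K : ℝ)) := by gcongr
      _ = (4 * Real.exp 1 / 3) ^ (2 * K) := by
          rw [mul_div_right_comm, mul_pow, ← Real.exp_nat_mul]
          push_cast
          rw [mul_one]
  · rw [show 4 * K = 2 * (2 * K) by ring, pow_mul 2 2 (2 * K)]
    refine pow_lt_pow_left₀ ?_ (by positivity) (by omega)
    linarith [Real.exp_one_lt_three]
end

section
/- For every integer K ≥ 1 and every integer N > 2K, the tail product satisfies ∏_{j=2K+1}^{N} 1/(1 − 2^{−j/K}) ≤ 2^{K}. -/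
/-- If `m * K ≤ j`, then `1 - 2^(-j/K)` is at least `1 - 2^(-m)`. -/
theorem one_sub_half_pow_le_one_sub_rpow {K m j : ℕ} (hK : 1 ≤ K) (hj : m * K ≤ j) :
    1 - (1 / 2 : ℝ) ^ m ≤ 1 - (2 : ℝ) ^ (-(j : ℝ) / (K : ℝ)) := by
  have hK' : (0 : ℝ) < K := by exact_mod_cast hK
  have hj' : (m : ℝ) * K ≤ j := by exact_mod_cast hj
  have hpow : (1 / 2 : ℝ) ^ m = (2 : ℝ) ^ (-(m : ℝ)) := by
    rw [Real.rpow_neg zero_le_two, Real.rpow_natCast, one_div, inv_pow]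
  rw [hpow]
  refine sub_le_sub_left (Real.rpow_le_rpow_of_exponent_le one_le_two ?_) 1
  rw [div_le_iff₀ hK']
  linarith

theorem one_sub_rpow_pos {K j : ℕ} (hK : 1 ≤ K) (hj : 1 ≤ j) :
    0 < 1 - (2 : ℝ) ^ (-(j : ℝ) / (K : ℝ)) := by
  have hK' : (0 : ℝ) < K := by exact_mod_cast hK
  have hj' : (0 : ℝ) < j := by exact_mod_cast hj
  exact sub_pos.2 (Real.rpow_lt_one_of_one_lt_of_neg one_lt_two
    (div_neg_of_neg_of_pos (neg_neg_of_pos hj') hK'))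

/-- Lower bound for the product over `n` consecutive blocks of length `K` starting after `2 * K`. -/
theorem pow_le_prod_Ioc_one_sub_rpow {K : ℕ} (hK : 1 ≤ K) (n : ℕ) :
    (1 / 2 + (1 / 2 : ℝ) ^ (n + 1)) ^ K ≤
      ∏ j ∈ Finset.Ioc (2 * K) ((n + 2) * K), (1 - (2 : ℝ) ^ (-(j : ℝ) / (K : ℝ))) := by
  induction n with
  | zero => norm_num
  | succ n ih =>
    have hx0 : (0 : ℝ) < (1 / 2) ^ n := by positivity
    have hx1 : (1 / 2 : ℝ) ^ n ≤ 1 := pow_le_one₀ (by norm_num) (by norm_num)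
    have hstep : 1 / 2 + (1 / 2 : ℝ) ^ (n + 1 + 1) ≤
        (1 / 2 + (1 / 2 : ℝ) ^ (n + 1)) * (1 - (1 / 2 : ℝ) ^ (n + 2)) := by
      simp only [pow_succ]
      nlinarith
    have hnonneg : (0 : ℝ) ≤ 1 - (1 / 2) ^ (n + 2) :=
      sub_nonneg.2 (pow_le_one₀ (by norm_num) (by norm_num))
    have hblock : (1 - (1 / 2 : ℝ) ^ (n + 2)) ^ K ≤
        ∏ j ∈ Finset.Ioc ((n + 2) * K) ((n + 1 + 2) * K),
          (1 - (2 : ℝ) ^ (-(j : ℝ) / (K : ℝ))) := by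
      have hcard : (Finset.Ioc ((n + 2) * K) ((n + 1 + 2) * K)).card = K := by
        rw [Nat.card_Ioc, ← Nat.sub_mul, show n + 1 + 2 - (n + 2) = 1 by omega, one_mul]
      calc (1 - (1 / 2 : ℝ) ^ (n + 2)) ^ K
          = ∏ _j ∈ Finset.Ioc ((n + 2) * K) ((n + 1 + 2) * K), (1 - (1 / 2 : ℝ) ^ (n + 2)) := by
            rw [Finset.prod_const, hcard]
        _ ≤ _ := Finset.prod_le_prod (fun _ _ => hnonneg) fun j hj =>
            one_sub_half_pow_le_one_sub_rpow hK (Finset.mem_Ioc.1 hj).1.le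
    calc (1 / 2 + (1 / 2 : ℝ) ^ (n + 1 + 1)) ^ K
        ≤ ((1 / 2 + (1 / 2 : ℝ) ^ (n + 1)) * (1 - (1 / 2 : ℝ) ^ (n + 2))) ^ K :=
          pow_le_pow_left₀ (by positivity) hstep K
      _ = (1 / 2 + (1 / 2 : ℝ) ^ (n + 1)) ^ K * (1 - (1 / 2 : ℝ) ^ (n + 2)) ^ K := mul_pow _ _ _
      _ ≤ _ := mul_le_mul ih hblock (pow_nonneg hnonneg K)
          ((pow_nonneg (by positivity) K).trans ih)
      _ = _ := Finset.prod_Ioc_consecutive _ (Nat.mul_le_mul_right K (by omega))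
          (Nat.mul_le_mul_right K (by omega))

theorem stmt6 (K : ℕ) (hK : 1 ≤ K) (N : ℕ) (hN : 2 * K < N) :
    ∏ j ∈ Finset.Icc (2 * K + 1) N, (1 - (2 : ℝ) ^ (-(j : ℝ) / (K : ℝ)))⁻¹ ≤ 2 ^ K := by
  have hsub : Finset.Icc (2 * K + 1) N ⊆ Finset.Ioc (2 * K) ((N + 2) * K) := by
    intro j hj
    rw [Finset.mem_Icc] at hj
    rw [Finset.mem_Ioc]
    exact ⟨by omega, by nlinarith⟩
  have hle : ∏ j ∈ Finset.Ioc (2 * K) ((N + 2) * K), (1 - (2 : ℝ) ^ (-(j : ℝ) / (K : ℝ))) ≤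
      ∏ j ∈ Finset.Icc (2 * K + 1) N, (1 - (2 : ℝ) ^ (-(j : ℝ) / (K : ℝ))) := by
    rw [← Finset.prod_sdiff hsub]
    refine mul_le_of_le_one_left (Finset.prod_nonneg fun j hj => ?_)
      (Finset.prod_le_one (fun j hj => ?_) fun j _ => ?_)
    · exact (one_sub_rpow_pos hK (by have := (Finset.mem_Icc.1 hj).1; omega)).le
    · have := (Finset.mem_Ioc.1 (Finset.mem_sdiff.1 hj).1).1
      exact (one_sub_rpow_pos hK (by omega)).le
    · exact sub_le_self 1 (by positivity)
  have hhalf : (1 / 2 : ℝ) ^ K ≤ (1 / 2 + (1 / 2 : ℝ) ^ (N + 1)) ^ K :=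
    pow_le_pow_left₀ (by norm_num) (le_add_of_nonneg_right (by positivity)) K
  rw [Finset.prod_inv_distrib]
  refine inv_le_of_inv_le₀ (by positivity) ?_
  rw [← inv_pow, ← one_div]
  exact hhalf.trans ((pow_le_prod_Ioc_one_sub_rpow hK N).trans hle)
end

section
/- Let K ≥ 1 and m ≥ 1 be integers, and for each integer i ≥ 0 define n_i = ⌊m · 2^{−i/K}⌋ (so n_0 = m). Let r ≥ 1 be an integer with 2^{r/K} ≤ m/(4K) (under these hypotheses n_{i−1} ≥ n_i + 2 ≥ n_r + 2 for all 1 ≤ i ≤ r). Then ∏_{i=1}^{r} n_{i−1}/(n_{i−1} − n_r) ≤ 2^{6K}. -/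
/-- A ratio `a / (a - b)` of perturbed quantities `a > X * Q - 1`, `b ≤ X`, with `X * δ ≥ 1`. -/
lemma div_sub_le_one_add_inv {a b X Q δ : ℝ} (hb : 0 ≤ b) (hbX : b ≤ X)
    (ha : X * Q - 1 < a) (hδ : 1 ≤ X * δ) (hD : 0 < Q - 1 - δ) :
    a / (a - b) ≤ 1 + 1 / (Q - 1 - δ) := by
  have h1 : b * (Q - δ) ≤ X * (Q - δ) := mul_le_mul_of_nonneg_right hbX (by linarith)
  have h2 : b * (Q - δ) < a := by nlinarith
  have h3 : 0 < a - b := by nlinarith [mul_nonneg hb hD.le]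
  have h4 : b / (a - b) ≤ 1 / (Q - 1 - δ) := by
    rw [div_le_div_iff₀ h3 hD]
    nlinarith
  have h5 : a / (a - b) = 1 + b / (a - b) := by
    field_simp
    ring
  linarith

lemma one_add_inv_mul_exp_le_sixty_four :
    (1 + 1 / (Real.log 2 - 1 / 4)) * Real.exp (1 + 4 / 3 / Real.log 2) ≤ 64 := by
  have hl := Real.log_two_gt_d9
  have h1 : 1 + 1 / (Real.log 2 - 1 / 4) ≤ 3.26 := by
    have : 1 / (Real.log 2 - 1 / 4) ≤ 2.26 := by
      rw [div_le_iff₀ (by linarith)]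
      linarith
    linarith
  have h2 : 1 + 4 / 3 / Real.log 2 ≤ 2.93 := by
    have : 4 / 3 / Real.log 2 ≤ 1.93 := by
      rw [div_le_iff₀ (by linarith)]
      linarith
    linarith
  have h3 : Real.exp 2.93 ≤ 19 := by
    have h4 : Real.exp 2.93 * Real.exp 0.07 = Real.exp 1 ^ 3 := by
      rw [← Real.exp_add, ← Real.exp_nat_mul]
      norm_num
    have h5 : Real.exp 1 ^ 3 ≤ 2.7183 ^ 3 :=
      pow_le_pow_left₀ (Real.exp_pos 1).le (by linarith [Real.exp_one_lt_d9]) 3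
    have h6 := Real.add_one_le_exp (0.07 : ℝ)
    nlinarith [Real.exp_pos 2.93]
  calc _ ≤ 3.26 * 19 :=
        mul_le_mul h1 ((Real.exp_le_exp.2 h2).trans h3) (Real.exp_pos _).le (by norm_num)
    _ ≤ 64 := by norm_num

section GeometricProduct

variable {K : ℕ} {q : ℝ}

lemma mul_log_two_div_le_pow_sub_one (hq : q = Real.exp (Real.log 2 / K)) (j : ℕ) :
    j * Real.log 2 / K ≤ q ^ j - 1 := by
  have h := Real.add_one_le_exp (j * (Real.log 2 / K))
  rw [Real.exp_nat_mul, ← hq, ← mul_div_assoc] at h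
  linarith

lemma pow_sub_one_sub_lower (hK : 1 ≤ K) (hq : q = Real.exp (Real.log 2 / K)) (j : ℕ) :
    (j + 1) * (Real.log 2 - 1 / 4) / K ≤ q ^ (j + 1) - 1 - 1 / (4 * K) := by
  have hK' : (0 : ℝ) < K := by exact_mod_cast hK
  have h := mul_log_two_div_le_pow_sub_one hq (j + 1)
  push_cast at h
  have h2 : (j + 1) * (Real.log 2 - 1 / 4) / K + 1 / (4 * K) ≤ (j + 1) * Real.log 2 / K := by
    have : (j + 1) * Real.log 2 / K - ((j + 1) * (Real.log 2 - 1 / 4) / K + 1 / (4 * K))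
        = j / (4 * K) := by
      field_simp
      ring
    have : (0 : ℝ) ≤ j / (4 * K) := by positivity
    linarith
  linarith

lemma pow_sub_one_sub_pos (hK : 1 ≤ K) (hq : q = Real.exp (Real.log 2 / K)) (j : ℕ) :
    0 < q ^ (j + 1) - 1 - 1 / (4 * K) := by
  have hK' : (0 : ℝ) < K := by exact_mod_cast hK
  have hl : 0 < Real.log 2 - 1 / 4 := by linarith [Real.log_two_gt_d9]
  exact lt_of_lt_of_le (by positivity) (pow_sub_one_sub_lower hK hq j)

lemma prod_initial_block_le (hK : 1 ≤ K) (hq : q = Real.exp (Real.log 2 / K)) :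
    ∏ j ∈ Finset.range K, (1 + 1 / (q ^ (j + 1) - 1 - 1 / (4 * K)))
      ≤ (1 + 1 / (Real.log 2 - 1 / 4)) ^ K * Real.exp K := by
  have hK' : (0 : ℝ) < K := by exact_mod_cast hK
  have hl : 0 < Real.log 2 - 1 / 4 := by linarith [Real.log_two_gt_d9]
  have hterm : ∀ j ∈ Finset.range K, 1 + 1 / (q ^ (j + 1) - 1 - 1 / (4 * K))
      ≤ (1 + 1 / (Real.log 2 - 1 / 4)) * (K / ((j + 1 : ℕ) : ℝ)) := by
    intro j hj
    have hjK : ((j + 1 : ℕ) : ℝ) ≤ K := by exact_mod_cast Finset.mem_range.1 hj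
    have h1 : 1 ≤ K / ((j + 1 : ℕ) : ℝ) := by
      rwa [one_le_div (by positivity)]
    have h2 : 1 / (q ^ (j + 1) - 1 - 1 / (4 * K))
        ≤ 1 / ((j + 1) * (Real.log 2 - 1 / 4) / K) :=
      one_div_le_one_div_of_le (by positivity) (pow_sub_one_sub_lower hK hq j)
    have h3 : 1 / ((j + 1) * (Real.log 2 - 1 / 4) / K)
        = 1 / (Real.log 2 - 1 / 4) * (K / ((j + 1 : ℕ) : ℝ)) := by
      push_cast
      rw [one_div_div, div_mul_div_comm, one_mul, mul_comm (Real.log 2 - 1 / 4)]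
    rw [add_mul, one_mul]
    linarith
  have hpos : ∀ j ∈ Finset.range K, 0 ≤ 1 + 1 / (q ^ (j + 1) - 1 - 1 / (4 * K)) := by
    intro j _
    have := pow_sub_one_sub_pos hK hq j
    positivity
  refine (Finset.prod_le_prod hpos hterm).trans ?_
  rw [Finset.prod_mul_distrib, Finset.prod_div_distrib, Finset.prod_const, Finset.prod_const,
    Finset.card_range, ← Nat.cast_prod, Finset.prod_range_add_one_eq_factorial]
  exact mul_le_mul_of_nonneg_left (Real.pow_div_factorial_le_exp _ hK'.le K) (by positivity)

lemma prod_tail_le (hK : 1 ≤ K) (hq : q = Real.exp (Real.log 2 / K)) (r : ℕ) :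
    ∏ j ∈ Finset.range r, (1 + 1 / (q ^ (K + j + 1) - 1 - 1 / (4 * K)))
      ≤ Real.exp (K * (4 / 3 / Real.log 2)) := by
  have hK1 : (1 : ℝ) ≤ K := by exact_mod_cast hK
  have hK' : (0 : ℝ) < K := by linarith
  have hl : 0 < Real.log 2 := by linarith [Real.log_two_gt_d9]
  have hq1 : Real.log 2 / K ≤ q - 1 := by
    simpa using mul_log_two_div_le_pow_sub_one hq 1
  have hq0 : 0 < Real.log 2 / K := by positivity
  have hqpos : 1 < q := by linarith
  have hqK : q ^ K = 2 := by
    rw [hq, ← Real.exp_nat_mul, mul_div_cancel₀ _ hK'.ne', Real.exp_log two_pos]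
  have hδ : 1 / (4 * (K : ℝ)) ≤ 1 / 4 :=
    one_div_le_one_div_of_le (by norm_num) (by linarith)
  have hterm : ∀ j ∈ Finset.range r, 1 + 1 / (q ^ (K + j + 1) - 1 - 1 / (4 * K))
      ≤ Real.exp (4 / 3 * (q⁻¹ * q⁻¹ ^ j)) := by
    intro j _
    have hp : 1 ≤ q ^ (j + 1) := one_le_pow₀ hqpos.le
    have h1 : 3 / 4 * q ^ (j + 1) ≤ q ^ (K + j + 1) - 1 - 1 / (4 * K) := by
      rw [add_assoc K j 1, pow_add q K, hqK]
      linarith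
    have h2 : 1 / (q ^ (K + j + 1) - 1 - 1 / (4 * K)) ≤ 4 / 3 * (q⁻¹ * q⁻¹ ^ j) := by
      refine (one_div_le_one_div_of_le (by positivity) h1).trans_eq ?_
      rw [← pow_succ', inv_pow]
      field_simp
    linarith [Real.add_one_le_exp (4 / 3 * (q⁻¹ * q⁻¹ ^ j))]
  have hpos : ∀ j ∈ Finset.range r, 0 ≤ 1 + 1 / (q ^ (K + j + 1) - 1 - 1 / (4 * K)) := by
    intro j _
    have := pow_sub_one_sub_pos hK hq (K + j)
    positivity
  refine (Finset.prod_le_prod hpos hterm).trans ?_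
  rw [← Real.exp_sum, ← Finset.mul_sum, ← Finset.mul_sum, Real.exp_le_exp]
  have hgeom : ∑ j ∈ Finset.range r, q⁻¹ ^ j ≤ (1 - q⁻¹)⁻¹ :=
    (summable_geometric_of_lt_one (by positivity) (inv_lt_one_of_one_lt₀ hqpos)).sum_le_tsum _
      (fun _ _ => by positivity) |>.trans_eq
      (tsum_geometric_of_lt_one (by positivity) (inv_lt_one_of_one_lt₀ hqpos))
  have hq' : q⁻¹ * (1 - q⁻¹)⁻¹ = 1 / (q - 1) := by
    rw [← mul_inv, mul_sub, mul_one, mul_inv_cancel₀ (by positivity), one_div]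
  calc 4 / 3 * (q⁻¹ * ∑ j ∈ Finset.range r, q⁻¹ ^ j)
      ≤ 4 / 3 * (q⁻¹ * (1 - q⁻¹)⁻¹) := by gcongr
    _ ≤ 4 / 3 * (1 / (Real.log 2 / K)) := by
        rw [hq']
        exact mul_le_mul_of_nonneg_left (one_div_le_one_div_of_le hq0 hq1) (by norm_num)
    _ = K * (4 / 3 / Real.log 2) := by
        field_simp

lemma prod_one_add_inv_le (hK : 1 ≤ K) (hq : q = Real.exp (Real.log 2 / K)) (r : ℕ) :
    ∏ j ∈ Finset.range r, (1 + 1 / (q ^ (j + 1) - 1 - 1 / (4 * K))) ≤ 2 ^ (6 * K) := by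
  have hl : 0 < Real.log 2 - 1 / 4 := by linarith [Real.log_two_gt_d9]
  have hone : ∀ j : ℕ, 1 ≤ 1 + 1 / (q ^ (j + 1) - 1 - 1 / (4 * K)) := by
    intro j
    have := one_div_pos.2 (pow_sub_one_sub_pos hK hq j)
    linarith
  have hext : ∏ j ∈ Finset.range r, (1 + 1 / (q ^ (j + 1) - 1 - 1 / (4 * K)))
      ≤ ∏ j ∈ Finset.range (K + r), (1 + 1 / (q ^ (j + 1) - 1 - 1 / (4 * K))) := by
    rw [add_comm K r, Finset.prod_range_add]
    refine le_mul_of_one_le_right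
      (Finset.prod_nonneg fun j _ => zero_le_one.trans (hone j)) ?_
    exact Finset.one_le_prod fun j _ => hone (r + j)
  refine hext.trans ?_
  rw [Finset.prod_range_add]
  calc _ ≤ ((1 + 1 / (Real.log 2 - 1 / 4)) ^ K * Real.exp K)
        * Real.exp (K * (4 / 3 / Real.log 2)) :=
        mul_le_mul (prod_initial_block_le hK hq) (prod_tail_le hK hq r)
          (Finset.prod_nonneg fun j _ => zero_le_one.trans (hone (K + j))) (by positivity)
    _ = ((1 + 1 / (Real.log 2 - 1 / 4)) * Real.exp (1 + 4 / 3 / Real.log 2)) ^ K := by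
        rw [mul_assoc, ← Real.exp_add, mul_pow, ← Real.exp_nat_mul, mul_add, mul_one]
    _ ≤ 64 ^ K := pow_le_pow_left₀ (by positivity) one_add_inv_mul_exp_le_sixty_four K
    _ = 2 ^ (6 * K) := by
        rw [pow_mul]
        norm_num

end GeometricProduct

theorem stmt8 (K m : ℕ) (hK : 1 ≤ K) (hm : 1 ≤ m)
    (nseq : ℕ → ℕ)
    (hn : ∀ i : ℕ, nseq i = ⌊(m : ℝ) * (2 : ℝ) ^ (-(i : ℝ) / (K : ℝ))⌋₊)
    (r : ℕ) (hr : 1 ≤ r)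
    (hrK : (2 : ℝ) ^ ((r : ℝ) / (K : ℝ)) ≤ (m : ℝ) / (4 * K)) :
    ∏ i ∈ Finset.Icc 1 r,
        ((nseq (i - 1) : ℝ) / ((nseq (i - 1) : ℝ) - (nseq r : ℝ))) ≤ 2 ^ (6 * K) := by
  have hK' : (0 : ℝ) < K := by exact_mod_cast hK
  obtain ⟨q, hq⟩ : ∃ q : ℝ, q = Real.exp (Real.log 2 / K) := ⟨_, rfl⟩
  set X : ℝ := (m : ℝ) * (2 : ℝ) ^ (-(r : ℝ) / (K : ℝ)) with hX
  have hX0 : 0 ≤ X := by positivity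
  have hXδ : 1 ≤ X * (1 / (4 * K)) := by
    have h := mul_le_mul_of_nonneg_right hrK
      (Real.rpow_nonneg zero_le_two (-(r : ℝ) / (K : ℝ)))
    rw [← Real.rpow_add two_pos, neg_div, add_neg_cancel, Real.rpow_zero] at h
    rw [hX, neg_div]
    exact h.trans_eq (by ring)
  have hreindex : ∏ i ∈ Finset.Icc 1 r,
      ((nseq (i - 1) : ℝ) / ((nseq (i - 1) : ℝ) - (nseq r : ℝ)))
      = ∏ j ∈ Finset.range r,
        ((nseq (r - 1 - j) : ℝ) / ((nseq (r - 1 - j) : ℝ) - (nseq r : ℝ))) := by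
    rw [Finset.prod_range_reflect
      (fun i => (nseq i : ℝ) / ((nseq i : ℝ) - (nseq r : ℝ))) r,
      ← Finset.Ico_add_one_right_eq_Icc, Finset.prod_Ico_eq_prod_range]
    simp
  have hr_le : (nseq r : ℝ) ≤ X := by
    rw [hn r]
    exact Nat.floor_le hX0
  have hlt : ∀ j ∈ Finset.range r, X * q ^ (j + 1) - 1 < (nseq (r - 1 - j) : ℝ) := by
    intro j hj
    have hjr : j + 1 ≤ r := Finset.mem_range.1 hj
    have hshift : X * q ^ (j + 1)
        = (m : ℝ) * (2 : ℝ) ^ (-((r - 1 - j : ℕ) : ℝ) / (K : ℝ)) := by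
      rw [hX, hq, ← Real.exp_nat_mul, mul_assoc, Real.rpow_def_of_pos two_pos,
        Real.rpow_def_of_pos two_pos, ← Real.exp_add, Nat.sub_sub, add_comm 1 j,
        Nat.cast_sub hjr]
      congr 2
      ring
    rw [hn, hshift]
    exact Nat.sub_one_lt_floor _
  have hdiv : ∀ j ∈ Finset.range r,
      (nseq (r - 1 - j) : ℝ) / ((nseq (r - 1 - j) : ℝ) - (nseq r : ℝ))
        ≤ 1 + 1 / (q ^ (j + 1) - 1 - 1 / (4 * K)) := fun j hj =>
    div_sub_le_one_add_inv (Nat.cast_nonneg _) hr_le (hlt j hj) hXδ (pow_sub_one_sub_pos hK hq j)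
  have hnonneg : ∀ j ∈ Finset.range r,
      0 ≤ (nseq (r - 1 - j) : ℝ) / ((nseq (r - 1 - j) : ℝ) - (nseq r : ℝ)) := by
    intro j hj
    have hD := pow_sub_one_sub_pos hK hq j
    have h : X ≤ X * q ^ (j + 1) - 1 := by
      nlinarith [mul_nonneg hX0 hD.le]
    exact div_nonneg (Nat.cast_nonneg _) (by linarith [hlt j hj])
  rw [hreindex]
  exact (Finset.prod_le_prod hnonneg hdiv).trans (prod_one_add_inv_le hK hq r)
end

section
/- Let K ≥ 1 and m ≥ 1 be integers, and for each integer i ≥ 0 define n_i = ⌊m · 2^{−i/K}⌋ (so n_0 = m). Let r ≥ 1 be an integer with 2^{r/K} ≤ m/(4K) (under these hypotheses n_{i−1} ≥ n_i + 2 ≥ n_r + 2 for all 1 ≤ i ≤ r). Then ∏_{i=1}^{r} [ C(n_{i−1} − n_r − 1, n_{i−1} − n_i − 1) / C(n_{i−1} − 1, n_{i−1} − n_i − 1) ] ≤ 2^{6K} / C(m, n_r). -/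
/-- The quotient of binomials is a quotient `C(b, s) / C(a, s)`, up to the factor `a / (a - s)`. -/
lemma choose_div_choose_eq {a b s : ℕ} (hba : b < a) (hsb : s ≤ b) :
    ((a - s - 1).choose (a - b - 1) : ℝ) / ((a - 1).choose (a - b - 1) : ℝ) =
      ((b.choose s : ℝ) / (a.choose s : ℝ)) * ((a : ℝ) / ((a : ℝ) - s)) := by
  obtain ⟨d, rfl⟩ := Nat.exists_eq_add_of_lt hba
  obtain ⟨c, rfl⟩ := Nat.exists_eq_add_of_le hsb
  have e1 : s + c + d + 1 - s - 1 = c + d := by omega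
  have e2 : s + c + d + 1 - (s + c) - 1 = d := by omega
  have e3 : s + c + d + 1 - 1 = (s + c) + d := by omega
  have e4 : s + c + d + 1 = s + (c + d + 1) := by omega
  have e5 : ((s + c + d + 1 : ℕ) : ℝ) - s = c + d + 1 := by push_cast; ring
  rw [e1, e2, e3, e5, e4, ← Nat.choose_symm_add (a := c) (b := d),
    ← Nat.choose_symm_add (a := s + c) (b := d),
    Nat.cast_add_choose, Nat.cast_add_choose, Nat.cast_add_choose, Nat.cast_add_choose]
  have e6 : s + (c + d + 1) = (s + c + d) + 1 := by omega
  rw [e6, Nat.factorial_succ (s + c + d), Nat.factorial_succ (c + d)]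
  push_cast
  field_simp

lemma prod_choose_div_choose_eq (n : ℕ → ℕ) (s r : ℕ) (hlt : ∀ i < r, n (i + 1) < n i)
    (hs : ∀ i ≤ r, s ≤ n i) :
    ∏ i ∈ Finset.range r, (((n i - s - 1).choose (n i - n (i + 1) - 1) : ℝ) /
        ((n i - 1).choose (n i - n (i + 1) - 1) : ℝ)) =
      (((n r).choose s : ℝ) / ((n 0).choose s : ℝ)) *
        ∏ i ∈ Finset.range r, ((n i : ℝ) / ((n i : ℝ) - s)) := by
  induction r with
  | zero =>
    have : ((n 0).choose s : ℝ) ≠ 0 := by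
      exact_mod_cast (Nat.choose_pos (hs 0 le_rfl)).ne'
    simp [this]
  | succ r ih =>
    have : ((n r).choose s : ℝ) ≠ 0 := by
      exact_mod_cast (Nat.choose_pos (hs r (by omega))).ne'
    rw [Finset.prod_range_succ, Finset.prod_range_succ,
      ih (fun i hi => hlt i (by omega)) (fun i hi => hs i (by omega)),
      choose_div_choose_eq (hlt r (by omega)) (hs (r + 1) le_rfl)]
    field_simp

lemma prod_add_div_eq_choose (N k : ℕ) :
    ∏ j ∈ Finset.range k, (((j : ℝ) + 1 + N) / ((j : ℝ) + 1)) = ((N + k).choose k : ℝ) := by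
  induction k with
  | zero => simp
  | succ k ih =>
    have h : ((N + k + 1 : ℕ) : ℝ) * ((N + k).choose k : ℝ) =
        ((N + k + 1).choose (k + 1) : ℝ) * ((k + 1 : ℕ) : ℝ) := by
      exact_mod_cast Nat.add_one_mul_choose_eq (N + k) k
    rw [Finset.prod_range_succ, ih, ← add_assoc N k 1]
    push_cast at h
    field_simp
    linarith

lemma quarter_le_prod_one_sub_half_pow (T : ℕ) :
    (1 / 4 : ℝ) ≤ ∏ t ∈ Finset.range T, (1 - (1 / 2 : ℝ) ^ (t + 1)) := by
  rcases T with _ | T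
  · norm_num
  suffices h : (1 / 4 : ℝ) + (1 / 2) ^ (T + 2) ≤
      ∏ t ∈ Finset.range (T + 1), (1 - (1 / 2 : ℝ) ^ (t + 1)) by
    have : (0 : ℝ) < (1 / 2) ^ (T + 2) := by positivity
    linarith
  induction T with
  | zero => norm_num
  | succ T ih =>
    rw [Finset.prod_range_succ]
    have h0 : (0 : ℝ) < (1 / 2) ^ T := by positivity
    have h1 : (1 / 2 : ℝ) ^ T ≤ 1 := pow_le_one₀ (by norm_num) (by norm_num)
    have e2 : (1 / 2 : ℝ) ^ (T + 2) = (1 / 2) ^ T / 4 := by ring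
    have e3 : (1 / 2 : ℝ) ^ (T + 1 + 2) = (1 / 2) ^ T / 8 := by ring
    have e4 : (1 / 2 : ℝ) ^ (T + 1 + 1) = (1 / 2) ^ T / 4 := by ring
    rw [e2] at ih
    rw [e3, e4]
    have := mul_le_mul_of_nonneg_right ih (show 0 ≤ 1 - (1 / 2 : ℝ) ^ T / 4 by linarith)
    nlinarith

/-- A product of factors at least one whose first `K` factors are dominated by those of a binomial
coefficient and whose later blocks of length `K` are dominated by `1 / (1 - 2⁻ᵗ)`. -/
lemma prod_le_two_pow (K r : ℕ) (hK : 1 ≤ K) (f : ℕ → ℝ) (hf : ∀ j < r, 0 ≤ f j)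
    (h1 : ∀ j < r, f j ≤ ((j : ℝ) + 1 + (3 * K : ℕ)) / ((j : ℝ) + 1))
    (h2 : ∀ j < r, K ≤ j → f j ≤ (1 - (1 / 2 : ℝ) ^ (j / K))⁻¹) :
    ∏ j ∈ Finset.range r, f j ≤ 2 ^ (6 * K) := by
  set h : ℕ → ℝ := fun j => if j < K then ((j : ℝ) + 1 + (3 * K : ℕ)) / ((j : ℝ) + 1)
    else (1 - (1 / 2 : ℝ) ^ (j / K))⁻¹ with hh
  have one_le : ∀ j, 1 ≤ h j := by
    intro j
    by_cases hj : j < K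
    · simp only [hh, hj, if_true]
      rw [le_div_iff₀ (by positivity)]
      have : (0 : ℝ) ≤ (3 * K : ℕ) := by positivity
      linarith
    · simp only [hh, hj, if_false]
      have hq : j / K ≠ 0 := (Nat.div_pos (by omega) (by omega)).ne'
      have : (1 / 2 : ℝ) ^ (j / K) < 1 := pow_lt_one₀ (by norm_num) (by norm_num) hq
      have : (0 : ℝ) < (1 / 2) ^ (j / K) := by positivity
      exact (one_le_inv₀ (by linarith)).2 (by linarith)
  have blocks : ∀ T : ℕ, ∏ j ∈ Finset.range (K + K * T), h j =
      ((3 * K + K).choose K : ℝ) *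
        ((∏ t ∈ Finset.range T, (1 - (1 / 2 : ℝ) ^ (t + 1)))⁻¹) ^ K := by
    intro T
    induction T with
    | zero =>
      rw [← prod_add_div_eq_choose]
      simp only [mul_zero, add_zero, Finset.range_zero, Finset.prod_empty, inv_one, one_pow,
        mul_one]
      refine Finset.prod_congr rfl fun j hj => ?_
      simp [hh, Finset.mem_range.1 hj]
    | succ T ih =>
      rw [Nat.mul_succ, ← add_assoc, Finset.prod_range_add, ih, Finset.prod_range_succ, mul_inv,
        mul_pow, mul_assoc]
      congr 2
      rw [Finset.prod_eq_pow_card (b := (1 - (1 / 2 : ℝ) ^ (T + 1))⁻¹), Finset.card_range]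
      intro u hu
      have hu := Finset.mem_range.1 hu
      have hdiv : (K + K * T + u) / K = T + 1 := by
        rw [show K + K * T + u = u + K * (T + 1) by ring, Nat.add_mul_div_left _ _ (by omega),
          Nat.div_eq_of_lt hu, zero_add]
      have hge : ¬ K + K * T + u < K := by omega
      simp only [hh, hge, if_false, hdiv]
  have hrT : r ≤ K + K * r := by nlinarith
  calc ∏ j ∈ Finset.range r, f j ≤ ∏ j ∈ Finset.range r, h j := by
        refine Finset.prod_le_prod (fun j hj => hf j (Finset.mem_range.1 hj)) fun j hj => ?_
        have hj := Finset.mem_range.1 hj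
        by_cases hjK : j < K
        · simpa [hh, hjK] using h1 j hj
        · simpa [hh, hjK] using h2 j hj (by omega)
    _ ≤ ∏ j ∈ Finset.range (K + K * r), h j := by
        exact Finset.prod_le_prod_of_subset_of_one_le (Finset.range_mono hrT)
          (fun j _ => zero_le_one.trans (one_le j)) fun j _ _ => one_le j
    _ = _ := blocks r
    _ ≤ 2 ^ (4 * K) * 4 ^ K := by
        have hP := quarter_le_prod_one_sub_half_pow r
        have hinv := inv_anti₀ (by norm_num) hP
        rw [show (1 / 4 : ℝ)⁻¹ = 4 by norm_num] at hinv
        have h0 := inv_nonneg.2 ((show (0 : ℝ) ≤ 1 / 4 by norm_num).trans hP)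
        have hC := Nat.choose_le_two_pow (3 * K + K) K
        rw [show 2 ^ (3 * K + K) = 2 ^ (4 * K) by ring] at hC
        exact mul_le_mul (by exact_mod_cast hC) (pow_le_pow_left₀ h0 hinv K) (by positivity)
          (by positivity)
    _ = 2 ^ (6 * K) := by
        rw [show (4 : ℝ) = 2 ^ 2 by norm_num, ← pow_mul, ← pow_add]
        congr 1; ring

lemma mul_le_two_rpow_sub_one {z : ℝ} (hz : 0 ≤ z) :
    0.69 * z ≤ 2 ^ z - 1 := by
  have h := Real.add_one_le_exp (Real.log 2 * z)
  rw [Real.rpow_def_of_pos two_pos]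
  nlinarith [Real.log_two_gt_d9]

/-- Consecutive terms of `⌊y 2^{j/K}⌋` with `4 K ≤ y` are far from `⌊y⌋`. -/
lemma floor_gap {K : ℕ} (hK : 1 ≤ K) {y : ℝ} (hy : 4 * K ≤ y) (j : ℕ) :
    y * (j + 1) + 3 * K * ⌊y⌋₊ ≤ 3 * K * ⌊y * 2 ^ (((j : ℝ) + 1) / K)⌋₊ := by
  have hK' : (1 : ℝ) ≤ K := by exact_mod_cast hK
  have hj : (0 : ℝ) ≤ j := by positivity
  have hz : (0 : ℝ) ≤ ((j : ℝ) + 1) / K := by positivity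
  have h := mul_le_two_rpow_sub_one hz
  have hfl := Nat.floor_le (show 0 ≤ y by linarith)
  have hfl' := Nat.lt_floor_add_one (y * (2 : ℝ) ^ (((j : ℝ) + 1) / K))
  have h3 : 0.69 * (y * (j + 1)) ≤ K * (y * 2 ^ (((j : ℝ) + 1) / K) - y) := by
    have := mul_le_mul_of_nonneg_left h (show 0 ≤ K * y by nlinarith)
    have e : K * y * (0.69 * (((j : ℝ) + 1) / K)) = 0.69 * (y * (j + 1)) := by field_simp
    linarith
  nlinarith [mul_nonneg (show 0 ≤ y by linarith) hj]

theorem stmt9 (K m : ℕ) (hK : 1 ≤ K) (hm : 1 ≤ m)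
    (nseq : ℕ → ℕ)
    (hn : ∀ i : ℕ, nseq i = ⌊(m : ℝ) * (2 : ℝ) ^ (-(i : ℝ) / (K : ℝ))⌋₊)
    (r : ℕ) (hr : 1 ≤ r)
    (hrK : (2 : ℝ) ^ ((r : ℝ) / (K : ℝ)) ≤ (m : ℝ) / (4 * K)) :
    ∏ i ∈ Finset.Icc 1 r,
        (((nseq (i - 1) - nseq r - 1).choose (nseq (i - 1) - nseq i - 1) : ℝ) /
          ((nseq (i - 1) - 1).choose (nseq (i - 1) - nseq i - 1) : ℝ)) ≤
      2 ^ (6 * K) / (m.choose (nseq r) : ℝ) := by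
  have hK' : (1 : ℝ) ≤ K := by exact_mod_cast hK
  set x : ℕ → ℝ := fun i => (m : ℝ) * (2 : ℝ) ^ (-(i : ℝ) / (K : ℝ)) with hx
  have hxadd : ∀ i k : ℕ, x i = x (i + k) * 2 ^ ((k : ℝ) / K) := by
    intro i k
    simp only [hx]
    rw [mul_assoc, ← Real.rpow_add two_pos]
    congr 2
    push_cast
    ring
  have hxr : 4 * K ≤ x r := by
    have h0 := hxadd 0 r
    have hx0 : x 0 = m := by simp [hx]
    rw [hx0, zero_add] at h0
    rw [le_div_iff₀ (by positivity), h0, mul_comm] at hrK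
    exact le_of_mul_le_mul_right hrK (by positivity)
  have hxi : ∀ i ≤ r, 4 * K ≤ x i := by
    intro i hi
    have h0 := hxadd i (r - i)
    rw [show i + (r - i) = r by omega] at h0
    have : (1 : ℝ) ≤ 2 ^ (((r - i : ℕ) : ℝ) / K) :=
      Real.one_le_rpow (by norm_num) (by positivity)
    nlinarith
  have gap : ∀ i j : ℕ, i + (j + 1) ≤ r →
      x (i + (j + 1)) * (j + 1) + 3 * K * nseq (i + (j + 1)) ≤ 3 * K * nseq i := by
    intro i j hij
    have h := floor_gap hK (hxi _ hij) j
    have e := hxadd i (j + 1)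
    push_cast at e
    rw [← e] at h
    rw [hn, hn]
    exact h
  have hltj : ∀ i j : ℕ, i + (j + 1) ≤ r → nseq (i + (j + 1)) < nseq i := by
    intro i j hij
    have h := gap i j hij
    have h' := hxi _ hij
    have : (0 : ℝ) ≤ j := by positivity
    have : (nseq (i + (j + 1)) : ℝ) < nseq i := by
      by_contra! hc
      nlinarith
    exact_mod_cast this
  have hlt : ∀ i < r, nseq (i + 1) < nseq i := fun i hi => hltj i 0 (by omega)
  have hslt : ∀ i < r, nseq r < nseq i := by
    intro i hi
    have := hltj i (r - i - 1) (by omega)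
    rwa [show i + (r - i - 1 + 1) = r by omega] at this
  have hs : ∀ i ≤ r, nseq r ≤ nseq i := by
    intro i hi
    rcases hi.lt_or_eq with h | rfl
    · exact (hslt i h).le
    · exact le_rfl
  have hn0 : nseq 0 = m := by simp [hn]
  have hshift : ∏ i ∈ Finset.Icc 1 r,
        (((nseq (i - 1) - nseq r - 1).choose (nseq (i - 1) - nseq i - 1) : ℝ) /
          ((nseq (i - 1) - 1).choose (nseq (i - 1) - nseq i - 1) : ℝ)) =
      ∏ i ∈ Finset.range r,
        (((nseq i - nseq r - 1).choose (nseq i - nseq (i + 1) - 1) : ℝ) /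
          ((nseq i - 1).choose (nseq i - nseq (i + 1) - 1) : ℝ)) := by
    rw [Finset.range_eq_Ico, ← Finset.Ico_add_one_right_eq_Icc,
      Finset.prod_Ico_eq_prod_range, ← Finset.range_eq_Ico]
    refine Finset.prod_congr (by simp) fun i _ => ?_
    rw [add_comm 1 i, Nat.add_sub_cancel]
  rw [hshift, prod_choose_div_choose_eq nseq (nseq r) r hlt hs, Nat.choose_self, hn0,
    Nat.cast_one, one_div_mul_eq_div]
  refine div_le_div_of_nonneg_right ?_ (by positivity)
  rw [← Finset.prod_range_reflect]
  have hpos : ∀ j < r, (0 : ℝ) < nseq (r - 1 - j) - nseq r := by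
    intro j hj
    rw [sub_pos]
    exact_mod_cast hslt (r - 1 - j) (by omega)
  refine prod_le_two_pow K r hK _ ?_ ?_ ?_
  · exact fun j hj => div_nonneg (by positivity) (hpos j hj).le
  · intro j hj
    have h := gap (r - 1 - j) j (by omega)
    rw [show r - 1 - j + (j + 1) = r by omega] at h
    rw [div_le_div_iff₀ (hpos j hj) (by positivity)]
    have hfl : (nseq r : ℝ) ≤ x r := by
      rw [hn]
      exact Nat.floor_le (by linarith)
    push_cast
    have : (0 : ℝ) ≤ j := by positivity
    nlinarith
  · intro j hj hKj
    set t := j / K with ht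
    have ht1 : t ≠ 0 := (Nat.div_pos hKj (by omega)).ne'
    have hle : 2 ^ t * nseq r ≤ nseq (r - 1 - j) := by
      rw [hn (r - 1 - j)]
      apply Nat.le_floor
      have hfl : (nseq r : ℝ) ≤ x r := by
        rw [hn]
        exact Nat.floor_le (by linarith)
      have e := hxadd (r - 1 - j) (j + 1)
      rw [show r - 1 - j + (j + 1) = r by omega] at e
      change _ ≤ x (r - 1 - j)
      rw [e]
      have htj : (2 : ℝ) ^ t ≤ 2 ^ (((j + 1 : ℕ) : ℝ) / K) := by
        rw [← Real.rpow_natCast]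
        refine Real.rpow_le_rpow_of_exponent_le (by norm_num) ?_
        rw [le_div_iff₀ (by positivity)]
        exact_mod_cast (Nat.div_mul_le_self j K).trans (Nat.le_succ j)
      push_cast at htj ⊢
      rw [mul_comm]
      gcongr
    have hle' : (2 : ℝ) ^ t * nseq r ≤ nseq (r - 1 - j) := by exact_mod_cast hle
    have hlt1 : (1 / 2 : ℝ) ^ t < 1 := pow_lt_one₀ (by norm_num) (by norm_num) ht1
    rw [← one_div, div_le_div_iff₀ (hpos j hj) (by linarith)]
    have hinv : (1 / 2 : ℝ) ^ t * 2 ^ t = 1 := by rw [← mul_pow]; norm_num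
    have := mul_le_mul_of_nonneg_left hle' (show (0 : ℝ) ≤ (1 / 2) ^ t by positivity)
    rw [← mul_assoc, hinv] at this
    linarith
end

section
/- For all integers m ≥ 1 and L ≥ 0, one has 2^m · ∏_{j=1}^{L} ( ∑_{r=0}^{⌊m/4^j⌋} C(m,r) ) ≤ 2^{10m}. -/
/-- Chernoff-type bound for a truncated binomial sum. -/
theorem sum_range_choose_le_one_add_inv_pow_mul_pow {m k : ℕ} (hk : k ≤ m) {y : ℝ} (hy : 1 ≤ y) :
    ∑ r ∈ Finset.range (k + 1), (m.choose r : ℝ) ≤ (1 + y⁻¹) ^ m * y ^ k := by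
  have hy0 : 0 < y := by linarith
  rw [add_comm 1, add_pow, Finset.sum_mul]
  calc ∑ r ∈ Finset.range (k + 1), (m.choose r : ℝ)
      ≤ ∑ r ∈ Finset.range (k + 1), y⁻¹ ^ r * 1 ^ (m - r) * (m.choose r : ℝ) * y ^ k := by
        refine Finset.sum_le_sum fun r hr => ?_
        have hrk : r ≤ k := Finset.mem_range_succ_iff.mp hr
        have h : 1 ≤ y⁻¹ ^ r * y ^ k := by
          rw [inv_pow, inv_mul_eq_div, one_le_div (by positivity)]
          exact pow_le_pow_right₀ hy hrk
        have hc : (0 : ℝ) ≤ m.choose r := by positivity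
        rw [one_pow, mul_one]
        nlinarith [mul_le_mul_of_nonneg_left h hc]
    _ ≤ _ := Finset.sum_le_sum_of_subset_of_nonneg
        (Finset.range_mono (by omega)) fun r _ _ => by positivity

theorem sum_range_div_four_pow_choose_le_exp (m j : ℕ) :
    ∑ r ∈ Finset.range (m / 4 ^ j + 1), (m.choose r : ℝ) ≤ Real.exp (2 * m * (2 ^ j)⁻¹) := by
  set k := m / 4 ^ j
  have hjk : (j * k : ℝ) ≤ m * (2 ^ j)⁻¹ := by
    rw [← div_eq_mul_inv, le_div_iff₀ (by positivity)]
    have hk : k * 4 ^ j ≤ m := Nat.div_mul_le_self m (4 ^ j)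
    have h : j * k * 2 ^ j ≤ m := calc
      j * k * 2 ^ j ≤ 2 ^ j * k * 2 ^ j := by gcongr; exact Nat.lt_two_pow_self.le
      _ = k * 4 ^ j := by rw [show 4 = 2 * 2 from rfl, mul_pow]; ring
      _ ≤ m := hk
    exact_mod_cast h
  have htwo : (2 : ℝ) ≤ Real.exp 1 := by linarith [Real.add_one_le_exp (1 : ℝ)]
  calc ∑ r ∈ Finset.range (k + 1), (m.choose r : ℝ)
      ≤ (1 + ((2 : ℝ) ^ j)⁻¹) ^ m * (2 ^ j) ^ k :=
        sum_range_choose_le_one_add_inv_pow_mul_pow (Nat.div_le_self _ _)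
          (one_le_pow₀ one_le_two)
    _ ≤ Real.exp ((2 ^ j)⁻¹) ^ m * (Real.exp 1 ^ j) ^ k := by
        gcongr
        linarith [Real.add_one_le_exp (((2 : ℝ) ^ j)⁻¹)]
    _ = Real.exp (m * (2 ^ j)⁻¹ + j * k) := by
        rw [← pow_mul, ← Real.exp_nat_mul, ← Real.exp_nat_mul, ← Real.exp_add]
        push_cast
        rw [mul_one]
    _ ≤ Real.exp (2 * m * (2 ^ j)⁻¹) := Real.exp_le_exp.mpr (by linarith)

theorem prod_sum_range_div_four_pow_choose_le_exp (m L : ℕ) :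
    ∏ j ∈ Finset.Icc 1 L, ∑ r ∈ Finset.range (m / 4 ^ j + 1), (m.choose r : ℝ) ≤
      Real.exp (2 * m * (1 - (2 ^ L)⁻¹)) := by
  induction L with
  | zero => simp
  | succ L ih =>
    rw [Finset.prod_Icc_succ_top (by omega)]
    refine (mul_le_mul ih (sum_range_div_four_pow_choose_le_exp m (L + 1))
      (by positivity) (by positivity)).trans_eq ?_
    rw [← Real.exp_add]
    congr 1
    rw [pow_succ, mul_inv]
    ring

theorem stmt10 (m L : ℕ) (hm : 1 ≤ m) :
    2 ^ m * ∏ j ∈ Finset.Icc 1 L, (∑ r ∈ Finset.range (m / 4 ^ j + 1), m.choose r) ≤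
      2 ^ (10 * m) := by
  have h : (2 : ℝ) ^ m * ∏ j ∈ Finset.Icc 1 L,
      ∑ r ∈ Finset.range (m / 4 ^ j + 1), (m.choose r : ℝ) ≤ 2 ^ (10 * m) := calc
    _ ≤ (2 : ℝ) ^ m * Real.exp (2 * m * (1 - (2 ^ L)⁻¹)) := by
        gcongr
        exact prod_sum_range_div_four_pow_choose_le_exp m L
    _ ≤ 2 ^ m * Real.exp ((2 * m : ℕ) * 1) := by
        push_cast
        gcongr
        exact sub_le_self _ (by positivity)
    _ = (2 * Real.exp 1 ^ 2) ^ m := by rw [Real.exp_nat_mul, pow_mul, ← mul_pow]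
    _ ≤ (2 ^ 10) ^ m := by
        gcongr
        nlinarith [Real.exp_one_lt_d9, Real.exp_pos 1]
    _ = 2 ^ (10 * m) := by rw [pow_mul]
  exact_mod_cast h
end

section
/- Let u ≥ 1 and m ≥ 1 be integers with m ≤ u/(4e), where e is Euler's number. Then there exists a collection 𝒮 of m-element subsets of {1,…,u} such that (i) for all distinct S, S' ∈ 𝒮 one has |S ∩ S'| < m/2, and (ii) |𝒮| ≥ ⌊ √( (u/(2em))^{m/2} − 1 ) ⌋. -/
/-- The number of `m`-sets containing `k` given points is at most a `(m / u) ^ k` fraction of all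
`m`-sets. -/
theorem pow_mul_choose_sub_le (u m k : ℕ) (hk : k ≤ m) (hm : m ≤ u) :
    u ^ k * (u - k).choose (m - k) ≤ m ^ k * u.choose m := by
  induction k with
  | zero => simp
  | succ k ih =>
    obtain ⟨a, rfl⟩ : ∃ a, m = k + 1 + a := ⟨m - (k + 1), by omega⟩
    obtain ⟨b, rfl⟩ : ∃ b, u = k + 1 + a + b := ⟨u - (k + 1 + a), by omega⟩
    have ih := ih (by omega)
    rw [show k + 1 + a + b - k = (a + b) + 1 by omega, show k + 1 + a - k = a + 1 by omega] at ih
    rw [show k + 1 + a + b - (k + 1) = a + b by omega, show k + 1 + a - (k + 1) = a by omega]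
    have hstep := Nat.add_one_mul_choose_eq (a + b) a
    have hratio : (k + 1 + a + b) * (a + b).choose a
        ≤ (k + 1 + a) * ((a + b) + 1).choose (a + 1) := by
      refine Nat.le_of_mul_le_mul_left ?_ (Nat.succ_pos a)
      calc (a + 1) * ((k + 1 + a + b) * (a + b).choose a)
          = ((a + 1) * (k + 1 + a + b)) * (a + b).choose a := by ring
        _ ≤ ((k + 1 + a) * (a + b + 1)) * (a + b).choose a := by
            gcongr ?_ * _
            nlinarith [Nat.zero_le (k * b)]
        _ = (k + 1 + a) * ((a + b + 1) * (a + b).choose a) := by ring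
        _ = (a + 1) * ((k + 1 + a) * ((a + b) + 1).choose (a + 1)) := by rw [hstep]; ring
    calc (k + 1 + a + b) ^ (k + 1) * (a + b).choose a
        = (k + 1 + a + b) ^ k * ((k + 1 + a + b) * (a + b).choose a) := by ring
      _ ≤ (k + 1 + a + b) ^ k * ((k + 1 + a) * ((a + b) + 1).choose (a + 1)) := by gcongr
      _ = (k + 1 + a) * ((k + 1 + a + b) ^ k * ((a + b) + 1).choose (a + 1)) := by ring
      _ ≤ (k + 1 + a) * ((k + 1 + a) ^ k * (k + 1 + a + b).choose (k + 1 + a)) := by gcongr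
      _ = (k + 1 + a) ^ (k + 1) * (k + 1 + a + b).choose (k + 1 + a) := by ring

open Finset in
theorem card_powersetCard_filter_superset_le {α : Type*} [Fintype α] [DecidableEq α]
    (T : Finset α) (m : ℕ) :
    #{S ∈ powersetCard m univ | T ⊆ S} ≤ (Fintype.card α - #T).choose (m - #T) := by
  rw [← card_compl, ← card_powersetCard]
  refine card_le_card_of_injOn (· \ T) ?_ ?_
  · intro S hS
    simp only [coe_filter, mem_powersetCard, Set.mem_ofPred_eq] at hS
    simp only [mem_coe, mem_powersetCard]
    refine ⟨fun x hx => ?_, ?_⟩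
    · simp_all
    · rw [card_sdiff_of_subset hS.2, hS.1.2]
  · intro S hS S' hS' h
    simp only [coe_filter, Set.mem_ofPred_eq] at hS hS'
    rw [← sdiff_union_of_subset hS.2, ← sdiff_union_of_subset hS'.2]
    exact congrArg (· ∪ T) h

open Finset in
theorem card_powersetCard_filter_inter_le {α : Type*} [Fintype α] [DecidableEq α]
    (S : Finset α) (m k : ℕ) :
    #{S' ∈ powersetCard m univ | k ≤ #(S ∩ S')}
      ≤ (#S).choose k * (Fintype.card α - k).choose (m - k) := by
  have hsub : {S' ∈ powersetCard m (univ : Finset α) | k ≤ #(S ∩ S')} ⊆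
      (powersetCard k S).biUnion fun T => {S' ∈ powersetCard m univ | T ⊆ S'} := by
    intro S' hS'
    obtain ⟨hS', hk⟩ := mem_filter.1 hS'
    obtain ⟨T, hT, hTk⟩ := exists_subset_card_eq hk
    exact mem_biUnion.2 ⟨T, mem_powersetCard.2 ⟨hT.trans inter_subset_left, hTk⟩,
      mem_filter.2 ⟨hS', hT.trans inter_subset_right⟩⟩
  refine (card_le_card hsub).trans ?_
  rw [← card_powersetCard]
  refine card_biUnion_le_card_mul _ _ _ fun T hT => ?_
  rw [← (mem_powersetCard.1 hT).2]
  exact card_powersetCard_filter_superset_le T m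

open Finset in
/-- The Gilbert–Varshamov bound for constant-weight families: a maximal family of `m`-sets with
pairwise intersections smaller than `k` is large. -/
theorem exists_family_card_inter_lt {α : Type*} [Fintype α] [DecidableEq α]
    (m k : ℕ) (hk : k ≤ m) :
    ∃ 𝒮 : Finset (Finset α), (∀ S ∈ 𝒮, #S = m) ∧
      (∀ S ∈ 𝒮, ∀ S' ∈ 𝒮, S ≠ S' → #(S ∩ S') < k) ∧
      (Fintype.card α).choose m
        ≤ #𝒮 * (m.choose k * (Fintype.card α - k).choose (m - k)) := by
  classical
  let P : Finset (Finset α) → Prop := fun 𝒮 =>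
    (∀ S ∈ 𝒮, #S = m) ∧ ∀ S ∈ 𝒮, ∀ S' ∈ 𝒮, S ≠ S' → #(S ∩ S') < k
  obtain ⟨𝒮, h𝒮, hmax⟩ := exists_max_image ({𝒮 | P 𝒮} : Finset (Finset (Finset α))) card
    ⟨∅, by simp [P]⟩
  obtain ⟨hcard, hinter⟩ : P 𝒮 := (mem_filter.1 h𝒮).2
  refine ⟨𝒮, hcard, hinter, ?_⟩
  have hcover : powersetCard m (univ : Finset α) ⊆
      𝒮.biUnion fun S => {S' ∈ powersetCard m univ | k ≤ #(S ∩ S')} := by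
    intro A hA
    have hAm := (mem_powersetCard.1 hA).2
    by_contra hnot
    have hfar : ∀ S ∈ 𝒮, #(S ∩ A) < k := by
      intro S hS
      by_contra! hle
      exact hnot (mem_biUnion.2 ⟨S, hS, mem_filter.2 ⟨hA, hle⟩⟩)
    have hA𝒮 : A ∉ 𝒮 := fun h => by
      have := hfar A h
      rw [inter_self] at this
      omega
    have hP : P (insert A 𝒮) := by
      refine ⟨fun S hS => ?_, fun S hS S' hS' hne => ?_⟩
      · rcases mem_insert.1 hS with rfl | hS
        exacts [hAm, hcard S hS]
      · rcases mem_insert.1 hS with rfl | hS₁ <;> rcases mem_insert.1 hS' with rfl | hS₂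
        · exact absurd rfl hne
        · rw [inter_comm]
          exact hfar S' hS₂
        · exact hfar S hS₁
        · exact hinter S hS₁ S' hS₂ hne
    have := hmax _ (mem_filter.2 ⟨mem_univ _, hP⟩)
    rw [card_insert_of_notMem hA𝒮] at this
    omega
  have hle := card_le_card hcover
  rw [card_powersetCard, card_univ] at hle
  refine hle.trans (card_biUnion_le_card_mul _ _ _ fun S hS => ?_)
  rw [← hcard S hS]
  exact card_powersetCard_filter_inter_le S #S k

theorem stmt11 (u m : ℕ) (hu : 1 ≤ u) (hm : 1 ≤ m)
    (hmu : (m : ℝ) ≤ (u : ℝ) / (4 * Real.exp 1)) :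
    ∃ 𝒮 : Finset (Finset (Fin u)),
      (∀ S ∈ 𝒮, S.card = m) ∧
      (∀ S ∈ 𝒮, ∀ S' ∈ 𝒮, S ≠ S' → ((S ∩ S').card : ℝ) < (m : ℝ) / 2) ∧
      ⌊Real.sqrt (((u : ℝ) / (2 * Real.exp 1 * m)) ^ ((m : ℝ) / 2) - 1)⌋₊ ≤ 𝒮.card := by
  have he : (2 : ℝ) ≤ Real.exp 1 := by linarith [Real.add_one_le_exp (1 : ℝ)]
  have hm0 : (0 : ℝ) < m := by exact_mod_cast hm
  rw [le_div_iff₀ (by positivity)] at hmu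
  have hmu' : m ≤ u := by
    have : (m : ℝ) ≤ u := by nlinarith
    exact_mod_cast this
  set k := (m + 1) / 2 with hkdef
  have hmk : m ≤ 2 * k := by omega
  have hkm : k ≤ m := by omega
  obtain ⟨𝒮, hcard, hinter, hbig⟩ := exists_family_card_inter_lt (α := Fin u) m k hkm
  refine ⟨𝒮, hcard, fun S hS S' hS' hne => ?_, ?_⟩
  · have h := hinter S hS S' hS' hne
    have h2 : 2 * (S ∩ S').card < m := by omega
    have : (2 : ℝ) * (S ∩ S').card < m := by exact_mod_cast h2
    linarith
  rw [Fintype.card_fin] at hbig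
  have hpow : u ^ k ≤ 𝒮.card * (4 * m) ^ k := by
    refine Nat.le_of_mul_le_mul_right ?_ (Nat.choose_pos (show m - k ≤ u - k by omega))
    calc u ^ k * (u - k).choose (m - k) ≤ m ^ k * u.choose m :=
          pow_mul_choose_sub_le u m k hkm hmu'
      _ ≤ m ^ k * (𝒮.card * (4 ^ k * (u - k).choose (m - k))) := by
          refine Nat.mul_le_mul_left _ (hbig.trans ?_)
          gcongr
          calc m.choose k ≤ 2 ^ m := Nat.choose_le_two_pow m k
            _ ≤ 2 ^ (2 * k) := Nat.pow_le_pow_right (by norm_num) hmk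
            _ = 4 ^ k := by rw [pow_mul]; norm_num
      _ = 𝒮.card * (4 * m) ^ k * (u - k).choose (m - k) := by rw [mul_pow]; ring
  set x : ℝ := (u : ℝ) / (2 * Real.exp 1 * m) with hx
  have hx1 : 1 ≤ x := by
    rw [hx, le_div_iff₀ (by positivity)]
    nlinarith
  have hxu : x ≤ u / (4 * m) := by
    rw [hx]
    gcongr
    linarith
  have hle : x ^ ((m : ℝ) / 2) ≤ 𝒮.card := by
    calc x ^ ((m : ℝ) / 2) ≤ x ^ (k : ℝ) := by
          refine Real.rpow_le_rpow_of_exponent_le hx1 ?_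
          have : (m : ℝ) ≤ 2 * k := by exact_mod_cast hmk
          linarith
      _ = x ^ k := Real.rpow_natCast x k
      _ ≤ (u / (4 * m)) ^ k := by gcongr
      _ ≤ 𝒮.card := by
          rw [div_pow, div_le_iff₀ (by positivity)]
          exact_mod_cast hpow
  have hy1 : 1 ≤ x ^ ((m : ℝ) / 2) := Real.one_le_rpow hx1 (by positivity)
  refine Nat.floor_le_of_le (le_trans ?_ hle)
  exact Real.sqrt_le_iff.2 ⟨by linarith, by nlinarith⟩
end

section
/- Let F be a finite field with q elements, let n ≥ 2 and k ≥ 1 be integers with 2k ≤ n, and let m be a natural number with q^m > C(n,2k) · q^{2k}. Then there exists a matrix Π ∈ F^{m×n} such that for all vectors w, w' ∈ F^n with w ≠ w', each having at most k nonzero entries, one has Πw ≠ Πw'. Equivalently, there exists Π ∈ F^{m×n} whose kernel contains no nonzero vector with at most 2k nonzero entries. -/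
open scoped Classical

/-- The matrices annihilating a fixed nonzero vector form a subgroup of index `|F| ^ |m|`. -/
theorem card_filter_mulVec_eq_zero_mul {F m n : Type*} [Field F] [Fintype F] [Fintype m]
    [Fintype n] {v : n → F} (hv : v ≠ 0) :
    (Finset.univ.filter fun M : Matrix m n F => M.mulVec v = 0).card *
      Fintype.card F ^ Fintype.card m = Fintype.card (Matrix m n F) := by
  obtain ⟨j, hj⟩ := Function.ne_iff.mp hv
  let f : Matrix m n F →+ (m → F) :=
    { toFun := fun M => M.mulVec v
      map_zero' := Matrix.zero_mulVec v
      map_add' := fun A B => Matrix.add_mulVec A B v }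
  have hf : Function.Surjective f := by
    intro u
    refine ⟨Matrix.of fun i l => if l = j then u i * (v j)⁻¹ else 0, ?_⟩
    funext i
    simpa [f, Matrix.mulVec, dotProduct] using inv_mul_cancel_right₀ hj (u i)
  have h := f.ker.card_mul_index
  rw [AddSubgroup.index_ker, AddMonoidHom.range_eq_top.mpr hf, AddSubgroup.card_top,
    Nat.card_eq_fintype_card, Nat.card_eq_fintype_card, Nat.card_eq_fintype_card,
    Fintype.card_fun] at h
  rw [← h, Fintype.card_subtype]
  simp [f, AddMonoidHom.mem_ker]

/-- A set of fewer than `|F| ^ |m|` nonzero vectors is avoided by the kernel of some matrix. -/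
theorem exists_matrix_forall_mulVec_ne_zero {F m n : Type*} [Field F] [Fintype F] [Fintype m]
    [Fintype n] (S : Finset (n → F)) (h0 : ∀ v ∈ S, v ≠ 0)
    (hS : S.card < Fintype.card F ^ Fintype.card m) :
    ∃ M : Matrix m n F, ∀ v ∈ S, M.mulVec v ≠ 0 := by
  by_contra! hbad
  have hcover : (Finset.univ : Finset (Matrix m n F)) ⊆
      S.biUnion fun v => Finset.univ.filter fun M => M.mulVec v = 0 := by
    intro M _
    simpa using hbad M
  have hle := (Finset.card_le_card hcover).trans Finset.card_biUnion_le
  have hmul := Nat.mul_le_mul_right (Fintype.card F ^ Fintype.card m) hle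
  rw [Finset.sum_mul, Finset.sum_congr rfl fun v hv => card_filter_mulVec_eq_zero_mul (h0 v hv),
    Finset.sum_const, smul_eq_mul, Finset.card_univ, mul_comm] at hmul
  exact hS.not_ge (Nat.le_of_mul_le_mul_right hmul Fintype.card_pos)

/-- There are at most `C(n, d) * |F| ^ d` vectors with at most `d` nonzero entries. -/
theorem card_filter_sparse_le {F n : Type*} [Zero F] [Fintype F] [Fintype n] [DecidableEq n]
    {d : ℕ} (hd : d ≤ Fintype.card n) :
    (Finset.univ.filter fun v : n → F => (Finset.univ.filter fun i => v i ≠ 0).card ≤ d).card ≤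
      (Fintype.card n).choose d * Fintype.card F ^ d := by
  have hcover : (Finset.univ.filter fun v : n → F =>
        (Finset.univ.filter fun i => v i ≠ 0).card ≤ d) ⊆
      (Finset.univ.powersetCard d).biUnion fun T : Finset n =>
        Finset.univ.image fun (g : T → F) i => if h : i ∈ T then g ⟨i, h⟩ else 0 := by
    intro v hv
    obtain ⟨T, hvT, hT⟩ := Finset.exists_superset_card_eq (Finset.mem_filter.mp hv).2 hd
    refine Finset.mem_biUnion.mpr ⟨T, by simp [hT], ?_⟩
    refine Finset.mem_image.mpr ⟨fun i => v i, Finset.mem_univ _, ?_⟩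
    funext i
    by_cases hi : i ∈ T
    · simp [hi]
    · have : v i = 0 := by
        by_contra h
        exact hi (hvT (by simpa using h))
      simp [hi, this]
  refine (Finset.card_le_card hcover).trans ((Finset.card_biUnion_le_card_mul _ _
    (Fintype.card F ^ d) fun T hT => Finset.card_image_le.trans ?_).trans ?_)
  · simp [(Finset.mem_powersetCard.mp hT).2]
  · simp

theorem stmt12 (F : Type*) [Field F] [Fintype F] (q : ℕ) (hq : Fintype.card F = q)
    (n k m : ℕ) (hn : 2 ≤ n) (hk : 1 ≤ k) (hkn : 2 * k ≤ n)
    (hm : n.choose (2 * k) * q ^ (2 * k) < q ^ m) :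
    ∃ Pi : Matrix (Fin m) (Fin n) F,
      ∀ w w' : Fin n → F, w ≠ w' →
        ({i | w i ≠ 0} : Set (Fin n)).toFinset.card ≤ k →
        ({i | w' i ≠ 0} : Set (Fin n)).toFinset.card ≤ k →
        Pi.mulVec w ≠ Pi.mulVec w' := by
  subst hq
  have hcard := card_filter_sparse_le (F := F) (n := Fin n) (d := 2 * k) (by simpa using hkn)
  rw [Fintype.card_fin] at hcard
  obtain ⟨M, hM⟩ := exists_matrix_forall_mulVec_ne_zero (m := Fin m)
    ((Finset.univ.filter fun v : Fin n → F =>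
      (Finset.univ.filter fun i => v i ≠ 0).card ≤ 2 * k).erase 0)
    (fun v hv => Finset.ne_of_mem_erase hv)
    (by rw [Fintype.card_fin]; exact (Finset.card_erase_le.trans hcard).trans_lt hm)
  refine ⟨M, fun w w' hne hw hw' heq => hM (w - w') ?_ ?_⟩
  · refine Finset.mem_erase.mpr ⟨sub_ne_zero.mpr hne, Finset.mem_filter.mpr
      ⟨Finset.mem_univ _, ?_⟩⟩
    have hsub : (Finset.univ.filter fun i => (w - w') i ≠ 0) ⊆
        ({i | w i ≠ 0} : Set (Fin n)).toFinset ∪ ({i | w' i ≠ 0} : Set (Fin n)).toFinset := by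
      intro i hi
      by_contra h
      simp_all
    have := (Finset.card_le_card hsub).trans (Finset.card_union_le _ _)
    omega
  · rw [Matrix.mulVec_sub, heq, sub_self]
end

section
/- Let m ≥ 1 and k ≥ 1 be natural numbers and let p ∈ [0,1] be a real number with m·p ≥ 4k. If X is a binomially distributed random variable with m trials and success probability p, then Pr(X ≥ k) ≥ 1/2. -/
theorem sum_binomial_eq_one (m : ℕ) (p : ℝ) :
    ∑ i ∈ Finset.range (m + 1), (m.choose i : ℝ) * p ^ i * (1 - p) ^ (m - i) = 1 := by
  have h := congrArg (Polynomial.eval p) (bernsteinPolynomial.sum ℝ m)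
  simpa [Polynomial.eval_finsetSum, bernsteinPolynomial] using h

theorem sum_binomial_variance (m : ℕ) (p : ℝ) :
    ∑ i ∈ Finset.range (m + 1),
      ((m : ℝ) * p - i) ^ 2 * ((m.choose i : ℝ) * p ^ i * (1 - p) ^ (m - i)) =
      m * p * (1 - p) := by
  have h := congrArg (Polynomial.eval p) (bernsteinPolynomial.variance ℝ m)
  simpa [Polynomial.eval_finsetSum, bernsteinPolynomial] using h

theorem stmt15 (m k : ℕ) (hm : 1 ≤ m) (hk : 1 ≤ k)
    (p : ℝ) (hp0 : 0 ≤ p) (hp1 : p ≤ 1)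
    (hmp : 4 * (k : ℝ) ≤ (m : ℝ) * p) :
    (1 : ℝ) / 2 ≤
      ∑ i ∈ Finset.Icc k m, (m.choose i : ℝ) * p ^ i * (1 - p) ^ (m - i) := by
  have hk' : (1 : ℝ) ≤ k := by exact_mod_cast hk
  have hm' : (1 : ℝ) ≤ m := by exact_mod_cast hm
  have hkm : k ≤ m := by
    have : (k : ℝ) ≤ m := by nlinarith
    exact_mod_cast this
  have hsum := sum_binomial_eq_one m p
  have hvar := sum_binomial_variance m p
  set b : ℕ → ℝ := fun i => (m.choose i : ℝ) * p ^ i * (1 - p) ^ (m - i) with hb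
  have hb0 : ∀ i, 0 ≤ b i := fun i => by
    have : 0 ≤ 1 - p := by linarith
    positivity
  have hsplit : ∑ i ∈ Finset.range k, b i + ∑ i ∈ Finset.Icc k m, b i = 1 := by
    rw [← hsum, ← Finset.sum_range_add_sum_Ico b (show k ≤ m + 1 by omega)]
    rfl
  have htail : (9 / 16 * ((m : ℝ) * p) ^ 2) * ∑ i ∈ Finset.range k, b i ≤ m * p * (1 - p) := by
    rw [← hvar, Finset.mul_sum]
    calc ∑ i ∈ Finset.range k, 9 / 16 * ((m : ℝ) * p) ^ 2 * b i
        ≤ ∑ i ∈ Finset.range k, ((m : ℝ) * p - i) ^ 2 * b i := by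
          refine Finset.sum_le_sum fun i hi => mul_le_mul_of_nonneg_right ?_ (hb0 i)
          have hik : (i : ℝ) ≤ k := by exact_mod_cast (Finset.mem_range.mp hi).le
          nlinarith
      _ ≤ ∑ i ∈ Finset.range (m + 1), ((m : ℝ) * p - i) ^ 2 * b i :=
          Finset.sum_le_sum_of_subset_of_nonneg
            (Finset.range_subset_range.mpr (by omega))
            fun i _ _ => mul_nonneg (sq_nonneg _) (hb0 i)
  have hS : ∑ i ∈ Finset.range k, b i ≤ 1 / 2 := by
    have hμ : 4 ≤ (m : ℝ) * p := by linarith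
    by_contra! h
    have h₁ : 9 / 16 * ((m : ℝ) * p) ^ 2 * (1 / 2) ≤
        9 / 16 * ((m : ℝ) * p) ^ 2 * ∑ i ∈ Finset.range k, b i := by gcongr
    have h₂ : (m : ℝ) * p * (1 - p) ≤ m * p := mul_le_of_le_one_right (by linarith) (by linarith)
    nlinarith
  linarith
end
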